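/- Let q be a prime power with q ≡ 1 (mod 4), let b ∈ F_q satisfy b² = −1, let f(x) = (x + 1)(x + b) ∈ F_q[x], and let α be a normal element of F_{q^4} over F_q. For any u, v ∈ F_q*, if γ = u·L_f(α) + v is a primitive element of F_{q^4}, then γ is 2-normal over F_q. -/

import Mathlib

open Polynomial

noncomputable section

/-- An element of a finite field is *primitive* if it generates the cyclic multiplicative
group, i.e. its multiplicative order is `card E - 1`. -/
def IsPrimitiveElem {E : Type*} [Field E] [Fintype E] (α : E) : Prop :=
  orderOf α = Fintype.card E - 1

/-- The polynomial `g_α(x) = Σ_{i=0}^{n-1} α^{q^i} x^{n-1-i} ∈ F_{q^n}[x]`. -/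
def gPoly {E : Type*} [Field E] (q n : ℕ) (α : E) : Polynomial E :=
  ∑ i ∈ Finset.range n, C (α ^ q ^ i) * X ^ (n - 1 - i)

/-- `α ∈ F_{q^n}` is `k`-normal over `F_q` if `gcd(x^n - 1, g_α(x))` in `F_{q^n}[x]`
has degree `k`. -/
def IsKNormal {E : Type*} [Field E] (q n k : ℕ) (α : E) : Prop :=
  (@EuclideanDomain.gcd (Polynomial E) _ (Classical.decEq _)
    ((X : Polynomial E) ^ n - 1) (gPoly q n α)).natDegree = k

/-- The linearized `q`-associate of `f = Σ a_i x^i ∈ F_q[x]`, evaluated at `α`: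
`L_f(α) = Σ a_i α^{q^i}`. -/
def Lf {F E : Type*} [Field F] [Field E] [Algebra F E] (q : ℕ) (f : Polynomial F) (α : E) : E :=
  ∑ i ∈ Finset.range (f.natDegree + 1), algebraMap F E (f.coeff i) * α ^ q ^ i

theorem IsKNormal.eval_gPoly_ne_zero {E : Type*} [Field E] {q n : ℕ} {α z : E} (hn : n ≠ 0)
    (hα : IsKNormal q n 0 α) (hz : z ^ n = 1) : (gPoly q n α).eval z ≠ 0 := by
  classical
  intro h
  unfold IsKNormal at hα
  have hd : X - C z ∣ @EuclideanDomain.gcd (Polynomial E) _ (Classical.decEq _)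
      ((X : Polynomial E) ^ n - 1) (gPoly q n α) :=
    @EuclideanDomain.dvd_gcd _ _ (Classical.decEq _) _ _ _
      (dvd_iff_isRoot.2 (by simp [hz])) (dvd_iff_isRoot.2 h)
  have h0 : @EuclideanDomain.gcd (Polynomial E) _ (Classical.decEq _)
      ((X : Polynomial E) ^ n - 1) (gPoly q n α) ≠ 0 := by
    intro h0
    have := (@EuclideanDomain.gcd_eq_zero_iff _ _ (Classical.decEq _) _ _).1 h0
    exact X_pow_sub_C_ne_zero (Nat.pos_of_ne_zero hn) (1 : E) (by simpa using this.1)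
  have := natDegree_le_of_dvd hd h0
  rw [hα, natDegree_X_sub_C] at this
  omega

theorem isKNormal_of_factor {E : Type*} [Field E] {q n : ℕ} {γ : E} {p r h : E[X]}
    (hX : (X : E[X]) ^ n - 1 = p * r) (hg : gPoly q n γ = p * h)
    (hc : IsCoprime r h) : IsKNormal q n p.natDegree γ := by
  unfold IsKNormal
  rw [hX, hg]
  refine natDegree_eq_of_degree_eq (degree_eq_degree_of_associated (associated_of_dvd_dvd ?_ ?_))
  · obtain ⟨s, t, hst⟩ := hc
    have : p = s * (p * r) + t * (p * h) := by linear_combination (-p) * hst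
    nth_rewrite 3 [this]
    exact dvd_add
      (Dvd.dvd.mul_left (@EuclideanDomain.gcd_dvd_left _ _ (Classical.decEq _) _ _) _)
      (Dvd.dvd.mul_left (@EuclideanDomain.gcd_dvd_right _ _ (Classical.decEq _) _ _) _)
  · exact @EuclideanDomain.dvd_gcd _ _ (Classical.decEq _) _ _ _
      (dvd_mul_right _ _) (dvd_mul_right _ _)

theorem not_isPrimitiveElem_of_pow_eq_mul {E : Type*} [Field E] [Fintype E] {q : ℕ}
    (hE : Fintype.card E = q ^ 4) (h5 : 5 ≤ q) {b γ : E} (hb : b ^ 4 = 1) (h : γ ^ q = b * γ) :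
    ¬ IsPrimitiveElem γ := by
  intro hp
  unfold IsPrimitiveElem at hp
  obtain ⟨m, rfl⟩ : ∃ m, q = m + 1 := ⟨q - 1, by omega⟩
  have hbig : 4 * m < (m + 1) ^ 4 - 1 := by
    have : (m + 1) ^ 4 = m ^ 4 + 4 * m ^ 3 + 6 * m ^ 2 + 4 * m + 1 := by ring
    have : 0 < m ^ 4 := by apply pow_pos; omega
    omega
  rw [hE] at hp
  have h0 : γ ≠ 0 := by
    rintro rfl
    rw [orderOf_zero] at hp
    omega
  have hm : γ ^ m = b := mul_right_cancel₀ h0 (by rw [← h, pow_succ])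
  have h1 : γ ^ (4 * m) = 1 := by rw [mul_comm, pow_mul, hm, hb]
  have := orderOf_le_of_pow_eq_one (by omega) h1
  omega

theorem Lf_X_add_one_mul_X_add_C {F E : Type*} [Field F] [Field E] [Algebra F E] (q : ℕ) (b : F)
    (α : E) : Lf q ((X + 1) * (X + C b) : F[X]) α =
      α ^ q ^ 2 + (1 + algebraMap F E b) * α ^ q + algebraMap F E b * α := by
  have he : ((X + 1) * (X + C b) : F[X]) = C 1 * X ^ 2 + C (1 + b) * X + C b := by
    simp only [C_add, C_1]; ring
  have hd : ((X + 1) * (X + C b) : F[X]).natDegree = 2 := by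
    rw [he]; exact natDegree_quadratic one_ne_zero
  unfold Lf
  rw [hd, he]
  simp [Finset.sum_range_succ, coeff_X, coeff_C, coeff_one]
  ring

/-- Let `q ≡ 1 (mod 4)` be a prime power, `b ∈ F_q` with `b² = -1`,
`f = (x + 1)(x + b) ∈ F_q[x]`, and `α` a normal element of `F_{q^4}` over `F_q`.
For `u, v ∈ F_q*`, if `γ = u·L_f(α) + v` is primitive in `F_{q^4}` then `γ` is
`2`-normal over `F_q`. -/
theorem primitive_implies_two_normal (q : ℕ) (hq : IsPrimePow q) (h4 : q % 4 = 1)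
    (F E : Type*) [Field F] [Fintype F] [Field E] [Fintype E] [Algebra F E]
    (hF : Fintype.card F = q) (hE : Fintype.card E = q ^ 4)
    (b : F) (hb : b ^ 2 = -1)
    (α : E) (hα : IsKNormal q 4 0 α)
    (u v : F) (hu : u ≠ 0) (hv : v ≠ 0)
    (hprim : IsPrimitiveElem
      (algebraMap F E u * Lf q ((X + 1) * (X + C b) : Polynomial F) α + algebraMap F E v)) :
    IsKNormal q 4 2
      (algebraMap F E u * Lf q ((X + 1) * (X + C b) : Polynomial F) α + algebraMap F E v) := by
  set B := algebraMap F E b with hB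
  set U := algebraMap F E u with hU
  set V := algebraMap F E v with hV
  have hB2 : B ^ 2 = -1 := by rw [hB, ← map_pow, hb]; simp
  have hB4 : B ^ 4 = 1 := by linear_combination (B ^ 2 - 1) * hB2
  have hU0 : U ≠ 0 := by simpa [hU] using hu
  have h5 : 5 ≤ q := by have := hq.one_lt; omega
  have h2 : (2 : E) ≠ 0 := by
    intro h2
    have hE0 : ((q ^ 4 : ℕ) : E) = 0 := by rw [← hE]; exact Nat.cast_card_eq_zero E
    have hq0 : (q : E) = 0 := by simpa using hE0
    rw [← Nat.div_add_mod q 4, h4] at hq0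
    push_cast at hq0
    exact one_ne_zero (α := E) (by linear_combination hq0 - 2 * ((q / 4 : ℕ) : E) * h2)
  have hB1 : B + 1 ≠ 0 := fun h => h2 (by linear_combination (B - 1) * (-h) + hB2)
  have hadd (x y : E) : (x + y) ^ q = x ^ q + y ^ q := by
    have := map_add (FiniteField.frobeniusAlgHom F E) x y
    simpa [FiniteField.coe_frobeniusAlgHom, hF] using this
  have hfix (a : F) : (algebraMap F E a) ^ q = algebraMap F E a := by
    rw [← map_pow, ← hF, FiniteField.pow_card]
  have hsucc (x : E) (i : ℕ) : x ^ q ^ (i + 1) = (x ^ q ^ i) ^ q := by rw [pow_succ, pow_mul]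
  have hα4 : α ^ q ^ 4 = α := by rw [← hE, FiniteField.pow_card]
  have hT := hα.eval_gPoly_ne_zero (by norm_num) hB4
  set γ := U * Lf q ((X + 1) * (X + C b) : F[X]) α + V with hγ
  rw [Lf_X_add_one_mul_X_add_C, ← hB] at hγ
  obtain ⟨a₁, ha₁⟩ : ∃ x, x = α ^ q := ⟨_, rfl⟩
  obtain ⟨a₂, ha₂⟩ : ∃ x, x = a₁ ^ q := ⟨_, rfl⟩
  obtain ⟨a₃, ha₃⟩ : ∃ x, x = a₂ ^ q := ⟨_, rfl⟩
  have ha₀ : a₃ ^ q = α := by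
    rw [ha₃, ha₂, ha₁, ← pow_mul, ← pow_mul, ← pow_mul]
    convert hα4 using 2; ring
  have e2 : α ^ q ^ 2 = a₂ := by rw [ha₂, ha₁, ← pow_mul, sq]
  have e3 : α ^ q ^ 3 = a₃ := by rw [hsucc, e2, ha₃]
  rw [e2, ← ha₁] at hγ
  have hγ1 : γ ^ q = U * (a₃ + (1 + B) * a₂ + B * a₁) + V := by
    rw [hγ]; simp only [hadd, mul_pow, hfix, ← ha₁, ← ha₂, ← ha₃, hB, hU, hV]
    simp only [one_pow]
  have hγ2 : γ ^ q ^ 2 = U * (α + (1 + B) * a₃ + B * a₂) + V := by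
    rw [sq, pow_mul, hγ1]; simp only [hadd, mul_pow, hfix, ha₀, ← ha₂, ← ha₃, hB, hU, hV]
    simp only [one_pow]
  have hγ3 : γ ^ q ^ 3 = U * (a₁ + (1 + B) * α + B * a₃) + V := by
    rw [hsucc, hγ2]; simp only [hadd, mul_pow, hfix, ha₀, ← ha₁, ← ha₃, hB, hU, hV]
    simp only [one_pow]
  simp only [gPoly, Finset.sum_range_succ, Finset.sum_range_zero, eval_add, eval_mul, eval_C,
    eval_pow, eval_X, e2, e3] at hT
  norm_num [← ha₁] at hT
  obtain ⟨c, hc⟩ : ∃ c, c = U * (1 + B) * (α + a₁ + a₂ + a₃) / 2 + V := ⟨_, rfl⟩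
  obtain ⟨d, hd⟩ : ∃ d, d = U * (1 + B) * B * (α - B * a₁ - a₂ + B * a₃) / 2 := ⟨_, rfl⟩
  have hd0 : d ≠ 0 := by
    have : 2 * d = -(U * (1 + B) * (α * B ^ 3 + a₁ * B ^ 2 + a₂ * B + a₃)) := by
      rw [hd]; field_simp; linear_combination ((1 + B) * (B * α + a₃)) * hB2
    intro h
    rw [h, mul_zero, eq_comm, neg_eq_zero] at this
    exact mul_ne_zero (mul_ne_zero hU0 (by rwa [add_comm])) hT this
  have g0 : γ = c + d := by
    rw [hγ, hc, hd]; field_simp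
    linear_combination U * (-α + (1 + B) * a₁ + a₂ - (1 + B) * a₃) * hB2
  have g1 : γ ^ q = c + B * d := by
    rw [hγ1, hc, hd]; field_simp
    linear_combination U * (-(1 + B) * α + (B ^ 2 + B - 1) * a₁ + (1 + B) * a₂
      - (B ^ 2 + B - 1) * a₃) * hB2
  have g2 : γ ^ q ^ 2 = c - d := by
    rw [hγ2, hc, hd]; field_simp
    linear_combination U * (α - (1 + B) * a₁ - a₂ + (1 + B) * a₃) * hB2
  have g3 : γ ^ q ^ 3 = c - B * d := by
    rw [hγ3, hc, hd]; field_simp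
    linear_combination U * ((1 + B) * α - (B ^ 2 + B - 1) * a₁ - (1 + B) * a₂
      + (B ^ 2 + B - 1) * a₃) * hB2
  have hc0 : c ≠ 0 := by
    intro h
    refine not_isPrimitiveElem_of_pow_eq_mul hE h5 hB4 ?_ hprim
    rw [g1, g0, h]; ring
  have hCB : (C B : E[X]) ^ 2 = -1 := by rw [← C_pow, hB2]; simp
  have hdeg : ((X + C 1) * (X + C B) : E[X]).natDegree = 2 := by
    rw [natDegree_mul (X_add_C_ne_zero _) (X_add_C_ne_zero _), natDegree_X_add_C,
      natDegree_X_add_C]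
  rw [← hdeg]
  refine isKNormal_of_factor (r := (X - C 1) * (X - C B))
    (h := C c * (X - C B) + C d * (X - C 1)) ?_ ?_ ?_
  · simp only [C_1]
    linear_combination (1 - X ^ 2) * (-1 : E[X]) * hCB
  · simp only [gPoly, Finset.sum_range_succ, Finset.sum_range_zero, g2, g3, pow_zero, pow_one, g1]
    rw [g0]
    norm_num
    linear_combination (C c * (X + 1)) * hCB
  · have h1B' : (1 : E) - B ≠ 0 := fun h => h2 (by linear_combination (1 + B) * h + hB2)
    have key (z : E) (p : E[X]) (h : p.eval z ≠ 0) : IsCoprime (X - C z) p :=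
      (irreducible_X_sub_C z).coprime_iff_not_dvd.2 fun h' => h (dvd_iff_isRoot.1 h')
    refine IsCoprime.mul_left (key _ _ ?_) (key _ _ ?_)
    · simpa using ⟨hc0, h1B'⟩
    · simpa using ⟨hd0, fun h => h1B' (by linear_combination -h)⟩


end
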